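/- arXiv:nlin/0701059 — 2 statements merged into one kernel-verified Lean document; each statement's English description precedes it below -/
import Mathlib

section
/- Let V ∈ ℂ[q₁,…,q_n] be homogeneous of degree k > 2 (n ≥ 2) such that the set 𝓓 = {d ∈ ℂⁿ \ {0} : V'(d) = d} has exactly (k−1)ⁿ − 1 elements and all Kovalevskaya exponents at each d ∈ 𝓓 are nonzero. Then Σ_{d ∈ 𝓓} Σ_{i=1}^{n−1} 1/Λᵢ(d) = −((k−1)ⁿ − n(k−2) − 1)/(k−2), where Λ₁(d),…,Λ_{n−1}(d) are the nontrivial Kovalevskaya exponents at d. (Equivalently, the sum over the D(n,k−1) Darboux points in projective space equals −((k−1)ⁿ − n(k−2) − 1)/(k−2)².) -/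
open MvPolynomial

/-! ### Reduction operator -/

open Classical in
/-- rewrite a monomial outside the box `[0,m)^n` with the relation `ε q_i^m = - F_i`. -/
noncomputable def redMon {n : ℕ} (m : ℕ) (F : Fin n → MvPolynomial (Fin n) ℂ) (a : Fin n →₀ ℕ) :
    MvPolynomial (Fin n) ℂ :=
  if h : ∃ i, m ≤ a i then
    monomial (a - Finsupp.single h.choose m) 1 * F h.choose else 0

noncomputable def redOp {n : ℕ} (m : ℕ) (F : Fin n → MvPolynomial (Fin n) ℂ) :
    MvPolynomial (Fin n) ℂ →ₗ[ℂ] MvPolynomial (Fin n) ℂ :=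
  (basisMonomials (Fin n) ℂ).constr ℂ (redMon m F)

lemma redOp_monomial {n : ℕ} (m : ℕ) (F : Fin n → MvPolynomial (Fin n) ℂ) (a : Fin n →₀ ℕ) :
    redOp m F (monomial a 1) = redMon m F a := by
  have := (basisMonomials (Fin n) ℂ).constr_basis ℂ (redMon m F) a
  rwa [coe_basisMonomials] at this

noncomputable abbrev lowDeg (n e : ℕ) : Submodule ℂ (MvPolynomial (Fin n) ℂ) :=
  restrictSupport ℂ {a | a.degree < e}

instance lowDeg_finite (n e : ℕ) : Module.Finite ℂ (lowDeg n e) := by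
  have : Finite {a : Fin n →₀ ℕ | a.degree < e} := by
    have hf : Finite {f : Fin n → ℕ | ∀ i, f i ∈ Set.Iio e} :=
      Set.Finite.pi' (fun _ => Set.finite_Iio e)
    refine Finite.of_injective
      (β := {f : Fin n → ℕ | ∀ i, f i ∈ Set.Iio e}) (fun a => ⟨fun i => a.1 i, fun i => ?_⟩) ?_
    · exact lt_of_le_of_lt (Finsupp.le_degree i a.1) a.2
    · intro a b h
      ext i
      exact congrFun (congrArg Subtype.val h) i
  exact Module.Finite.of_basis (basisRestrictSupport ℂ _)

lemma map_mem_of_monomial {n e : ℕ}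
    {W : Submodule ℂ (MvPolynomial (Fin n) ℂ)}
    (L : MvPolynomial (Fin n) ℂ →ₗ[ℂ] MvPolynomial (Fin n) ℂ)
    (h : ∀ a : Fin n →₀ ℕ, a.degree < e → L (monomial a 1) ∈ W) {p : MvPolynomial (Fin n) ℂ}
    (hp : p ∈ lowDeg n e) : L p ∈ W := by
  rw [lowDeg, restrictSupport_eq_span] at hp
  have : Submodule.span ℂ ((fun a => monomial a (1:ℂ)) '' {a : Fin n →₀ ℕ | a.degree < e}) ≤
      W.comap L := by
    rw [Submodule.span_le]
    rintro _ ⟨a, ha, rfl⟩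
    exact h a ha
  exact this hp

lemma monomial_mul_mem_lowDeg {n d e : ℕ} (a : Fin n →₀ ℕ) {q : MvPolynomial (Fin n) ℂ}
    (hq : q.totalDegree ≤ d) (h : a.degree + d < e) : monomial a 1 * q ∈ lowDeg n e := by
  rw [mem_restrictSupport_iff]
  intro b hb
  have h1 := le_totalDegree hb
  have h2 := totalDegree_mul (monomial a (1:ℂ)) q
  have h3 : (monomial a (1:ℂ)).totalDegree = a.degree := by
    rw [totalDegree_monomial _ one_ne_zero]; rfl
  have h4 : b.degree ≤ (monomial a (1:ℂ) * q).totalDegree := h1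
  simp only [Set.mem_ofPred_eq]
  omega

lemma degree_sub_single {n m : ℕ} {a : Fin n →₀ ℕ} {i : Fin n} (h : m ≤ a i) :
    (a - Finsupp.single i m).degree + m = a.degree := by
  have : a - Finsupp.single i m + Finsupp.single i m = a :=
    tsub_add_cancel_of_le (by simpa using h)
  conv_rhs => rw [← this]
  simp [Finsupp.degree_single]

lemma redOp_mem {n m : ℕ} {F : Fin n → MvPolynomial (Fin n) ℂ}
    (hF : ∀ i, (F i).totalDegree ≤ m) {e : ℕ} {p : MvPolynomial (Fin n) ℂ}
    (hp : p ∈ lowDeg n e) : redOp m F p ∈ lowDeg n e := by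
  refine map_mem_of_monomial _ (fun a ha => ?_) hp
  rw [redOp_monomial, redMon]
  split_ifs with h
  · exact monomial_mul_mem_lowDeg _ (hF _) (by rw [degree_sub_single h.choose_spec]; exact ha)
  · exact zero_mem _

lemma redOp_sub_mem {n m : ℕ} (hm : 2 ≤ m) {F F' : Fin n → MvPolynomial (Fin n) ℂ}
    (hF : ∀ i, (F i - F' i).totalDegree ≤ 0) {e : ℕ} {p : MvPolynomial (Fin n) ℂ}
    (hp : p ∈ lowDeg n (e + 2)) : redOp m F p - redOp m F' p ∈ lowDeg n e := by
  rw [← LinearMap.sub_apply]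
  refine map_mem_of_monomial _ (fun a ha => ?_) hp
  rw [LinearMap.sub_apply, redOp_monomial, redOp_monomial, redMon, redMon]
  split_ifs with h
  · rw [← mul_sub]
    have := degree_sub_single h.choose_spec
    exact monomial_mul_mem_lowDeg _ (hF _) (by omega)
  · simp

/-- `ε` is good if `ε + S` is injective. -/
def GoodEps {n : ℕ} (m : ℕ) (F : Fin n → MvPolynomial (Fin n) ℂ) (ε : ℂ) : Prop :=
  ∀ p, ε • p + redOp m F p = 0 → p = 0

lemma GoodEps.exists_mem {n m : ℕ} {F : Fin n → MvPolynomial (Fin n) ℂ}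
    (hF : ∀ i, (F i).totalDegree ≤ m) {ε : ℂ} (h : GoodEps m F ε) {e : ℕ}
    {p : MvPolynomial (Fin n) ℂ} (hp : p ∈ lowDeg n e) :
    ∃ q ∈ lowDeg n e, ε • q + redOp m F q = p := by
  let T : MvPolynomial (Fin n) ℂ →ₗ[ℂ] MvPolynomial (Fin n) ℂ := ε • LinearMap.id + redOp m F
  have hT : ∀ x ∈ lowDeg n e, T x ∈ lowDeg n e := fun x hx =>
    add_mem (Submodule.smul_mem _ _ hx) (redOp_mem hF hx)
  have hi : Function.Injective (T.restrict hT) := by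
    rw [injective_iff_map_eq_zero]
    intro x hx
    have := congrArg Subtype.val hx
    exact Subtype.ext (h _ this)
  obtain ⟨q, hq⟩ := (LinearMap.injective_iff_surjective.1 hi) ⟨p, hp⟩
  exact ⟨q, q.2, congrArg Subtype.val hq⟩

lemma countable_not_goodEps {n m : ℕ} (F : Fin n → MvPolynomial (Fin n) ℂ) :
    {ε | ¬ GoodEps m F ε}.Countable := by
  have key : ∀ ε : {ε | ¬ GoodEps m F ε}, ∃ p, p ≠ 0 ∧ ε.1 • p + redOp m F p = 0 := by
    rintro ⟨ε, h⟩
    simp only [GoodEps, Set.mem_ofPred_eq] at h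
    push Not at h
    obtain ⟨p, h1, h2⟩ := h
    exact ⟨p, h2, h1⟩
  choose p hp0 hp using key
  have hli := Module.End.eigenvectors_linearIndependent' (-(redOp m F) : Module.End ℂ _)
    (fun ε : {ε | ¬ GoodEps m F ε} => ε.1) Subtype.coe_injective p (fun ε => by
      rw [Module.End.hasEigenvector_iff]
      refine ⟨?_, hp0 ε⟩
      rw [Module.End.mem_eigenspace_iff]
      have := hp ε
      rw [add_comm] at this
      simp only [LinearMap.neg_apply]
      exact (neg_eq_of_add_eq_zero_right this))
  have h1 := hli.cardinal_lift_le_rank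
  have h2 : Module.rank ℂ (MvPolynomial (Fin n) ℂ) ≤ Cardinal.aleph0 := by
    rw [← (basisMonomials (Fin n) ℂ).mk_eq_rank'']
    exact Cardinal.mk_le_aleph0
  rw [← Cardinal.le_aleph0_iff_set_countable]
  simpa using h1.trans (Cardinal.lift_le.2 h2)

lemma exists_goodEps {n m : ℕ} (F F' : Fin n → MvPolynomial (Fin n) ℂ) {r : ℝ} (hr : 0 < r) :
    ∃ ε : ℂ, ε ≠ 0 ∧ ‖ε‖ < r ∧ GoodEps m F ε ∧ GoodEps m F' ε := by
  have hc : ({ε | ¬ GoodEps m F ε} ∪ {ε | ¬ GoodEps m F' ε} ∪ {0} : Set ℂ).Countable :=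
    ((countable_not_goodEps F).union (countable_not_goodEps F')).union (Set.countable_singleton 0)
  obtain ⟨ε, h1, h2⟩ := (hc.dense_compl ℝ).exists_mem_open Metric.isOpen_ball
    ⟨0, Metric.mem_ball_self hr⟩
  simp only [Set.mem_compl_iff, Set.mem_union, Set.mem_ofPred_eq, Set.mem_singleton_iff,
    not_or, not_not] at h1
  exact ⟨ε, h1.2, by simpa using h2, h1.1.1, h1.1.2⟩

/-- exponent of a box point -/
noncomputable def boxExp {n m : ℕ} (b : Fin n → Fin m) : Fin n →₀ ℕ :=
  Finsupp.equivFunOnFinite.symm fun i => (b i : ℕ)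

lemma eval_redOp {n m : ℕ} {F : Fin n → MvPolynomial (Fin n) ℂ} {ε : ℂ} {z : Fin n → ℂ}
    (hz : ∀ i, ε * z i ^ m + eval z (F i) = 0) (p : MvPolynomial (Fin n) ℂ) :
    eval z (ε • p + redOp m F p) =
      ε * ∑ b : Fin n → Fin m, coeff (boxExp b) p * eval z (monomial (boxExp b) 1) := by
  classical
  induction p using MvPolynomial.induction_on' with
  | monomial a c =>
    have hc : monomial a c = c • monomial a (1:ℂ) := by simp [smul_monomial]
    have h1 : eval z (ε • monomial a (1:ℂ) + redOp m F (monomial a 1)) =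
      ε * ∑ b : Fin n → Fin m, coeff (boxExp b) (monomial a (1:ℂ)) *
        eval z (monomial (boxExp b) 1) := by
      rw [redOp_monomial, redMon]
      split_ifs with h
      · have h0 : ∀ b : Fin n → Fin m, a ≠ boxExp b := by
          rintro b rfl
          have := h.choose_spec
          simp only [boxExp, Finsupp.equivFunOnFinite_symm_apply_apply] at this
          omega
        simp only [coeff_monomial, h0, if_false, zero_mul, Finset.sum_const_zero, mul_zero]
        have : a - Finsupp.single h.choose m + Finsupp.single h.choose m = a :=
          tsub_add_cancel_of_le (by simpa using h.choose_spec)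
        have h2 : monomial a (1:ℂ) =
            monomial (a - Finsupp.single h.choose m) 1 * X h.choose ^ m := by
          rw [X_pow_eq_monomial, monomial_mul, this, one_mul]
        have h3 := hz h.choose
        rw [h2]
        simp only [smul_eval, map_add, map_mul, map_pow, eval_X]
        linear_combination (eval z (monomial (a - Finsupp.single h.choose m) (1:ℂ))) * h3
      · push Not at h
        have h0 : a = boxExp (fun i => (⟨a i, h i⟩ : Fin m)) := by
          ext i; simp [boxExp]
        have hinj : ∀ b : Fin n → Fin m, a = boxExp b → b = (fun i => (⟨a i, h i⟩ : Fin m)) := by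
          rintro b rfl
          ext i; simp [boxExp]
        rw [Finset.sum_eq_single (fun i => (⟨a i, h i⟩ : Fin m))]
        · rw [← h0]; simp [smul_eval]
        · intro b _ hb
          rw [coeff_monomial, if_neg (fun h' => hb (hinj b h')), zero_mul]
        · simp
    rw [hc, map_smul, smul_comm, ← smul_add, smul_eval, h1]
    simp only [coeff_smul, smul_eq_mul, Finset.mul_sum]
    exact Finset.sum_congr rfl fun b _ => by ring
  | add p q hp hq =>
    have : ε • (p + q) + redOp m F (p + q) =
      (ε • p + redOp m F p) + (ε • q + redOp m F q) := by
      rw [map_add, smul_add]; abel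
    rw [this, map_add, hp, hq, ← mul_add, ← Finset.sum_add_distrib]
    simp only [coeff_add, add_mul]

lemma exists_indicator {n : ℕ} {ι : Type*} [Fintype ι] [DecidableEq ι] (z : ι → Fin n → ℂ)
    (hz : Function.Injective z) (s : ι) (j : Fin n) :
    ∃ p : MvPolynomial (Fin n) ℂ, ∀ t, eval (z t) p = if t = s then 1 else 0 := by
  have : ∀ t, ∃ i, t ≠ s → z s i ≠ z t i := by
    intro t
    by_cases h : t = s
    · exact ⟨j, fun h' => absurd h h'⟩
    · obtain ⟨i, hi⟩ := Function.ne_iff.1 (hz.ne (Ne.symm h))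
      exact ⟨i, fun _ => hi⟩
  choose i hi using this
  refine ⟨∏ t ∈ Finset.univ.erase s, C (z s (i t) - z t (i t))⁻¹ * (X (i t) - C (z t (i t))), ?_⟩
  intro t
  rw [map_prod]
  split_ifs with h
  · subst h
    apply Finset.prod_eq_one
    intro u hu
    have := sub_ne_zero.2 (hi u (Finset.ne_of_mem_erase hu))
    simp [inv_mul_cancel₀ this]
  · exact Finset.prod_eq_zero (Finset.mem_erase.2 ⟨h, Finset.mem_univ t⟩) (by simp)

lemma mem_lowDeg_self {n : ℕ} (p : MvPolynomial (Fin n) ℂ) : p ∈ lowDeg n (p.totalDegree + 1) := by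
  rw [mem_restrictSupport_iff]
  intro b hb
  exact Nat.lt_succ_of_le (le_totalDegree hb)

/-- The sum of the coordinates of the zeros is the trace of multiplication. -/
lemma sum_coord_eq {n m : ℕ} {ι : Type*} [Fintype ι] (hcard : Fintype.card ι = m ^ n)
    {F : Fin n → MvPolynomial (Fin n) ℂ} (hF : ∀ i, (F i).totalDegree ≤ m) {ε : ℂ}
    (hg : GoodEps m F ε) (z : ι → Fin n → ℂ) (hz : Function.Injective z)
    (hzF : ∀ s i, ε * z s i ^ m + eval (z s) (F i) = 0) (j : Fin n)
    (P : (Fin n → Fin m) → MvPolynomial (Fin n) ℂ)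
    (hP : ∀ a, ε • P a + redOp m F (P a) = X j * monomial (boxExp a) 1) :
    ∑ s, z s j = ∑ a, ε * coeff (boxExp a) (P a) := by
  classical
  let E : Matrix ι (Fin n → Fin m) ℂ := Matrix.of fun s a => eval (z s) (monomial (boxExp a) 1)
  let T : Matrix (Fin n → Fin m) (Fin n → Fin m) ℂ :=
    Matrix.of fun b a => ε * coeff (boxExp b) (P a)
  have hET : Matrix.diagonal (fun s => z s j) * E = E * T := by
    ext s a
    have := eval_redOp (hzF s) (P a)
    rw [hP] at this
    rw [Matrix.diagonal_mul, Matrix.mul_apply]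
    simp only [E, T, Matrix.of_apply]
    rw [map_mul, eval_X] at this
    rw [this, Finset.mul_sum]
    exact Finset.sum_congr rfl fun b _ => by ring
  have hX : ∃ Y : Matrix (Fin n → Fin m) ι ℂ, E * Y = 1 := by
    choose p hp using fun s => exists_indicator z hz s j
    choose q _ hq using fun s => hg.exists_mem hF (mem_lowDeg_self (p s))
    refine ⟨Matrix.of fun b s => ε * coeff (boxExp b) (q s), ?_⟩
    ext t s
    have := eval_redOp (hzF t) (q s)
    rw [hq, hp] at this
    rw [Matrix.mul_apply, Matrix.one_apply, this, Finset.mul_sum]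
    simp only [E, Matrix.of_apply]
    exact Finset.sum_congr rfl fun b _ => by ring
  obtain ⟨Y, hY⟩ := hX
  have hY' : Y * E = 1 := (Matrix.mul_eq_one_comm_of_card_eq _ _ _ (by simp [hcard])).1 hY
  have h1 : Matrix.diagonal (fun s => z s j) = E * T * Y := by
    rw [← hET, Matrix.mul_assoc, hY, Matrix.mul_one]
  have h2 : (Matrix.diagonal (fun s => z s j)).trace = T.trace := by
    rw [h1, Matrix.mul_assoc, Matrix.trace_mul_comm, Matrix.mul_assoc, hY', Matrix.mul_one]
  simpa [Matrix.trace, T] using h2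

lemma sum_coord_indep {n m : ℕ} (hm : 2 ≤ m) {ι : Type*} [Fintype ι]
    (hcard : Fintype.card ι = m ^ n)
    {F F' : Fin n → MvPolynomial (Fin n) ℂ} (hF : ∀ i, (F i).totalDegree ≤ m)
    (hF' : ∀ i, (F' i).totalDegree ≤ m) (hFF : ∀ i, (F i - F' i).totalDegree ≤ 0) {ε : ℂ}
    (hg : GoodEps m F ε) (hg' : GoodEps m F' ε) (z z' : ι → Fin n → ℂ)
    (hz : Function.Injective z) (hz' : Function.Injective z')
    (hzF : ∀ s i, ε * z s i ^ m + eval (z s) (F i) = 0)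
    (hzF' : ∀ s i, ε * z' s i ^ m + eval (z' s) (F' i) = 0) (j : Fin n) :
    ∑ s, z s j = ∑ s, z' s j := by
  have hmem : ∀ a : Fin n → Fin m,
      X j * monomial (boxExp a) (1:ℂ) ∈ lowDeg n ((boxExp a).degree + 2) := by
    intro a
    rw [mul_comm]
    exact monomial_mul_mem_lowDeg (d := 1) _ (by simp) (by omega)
  choose P hPm hP using fun a => hg.exists_mem hF (hmem a)
  choose P' hPm' hP' using fun a => hg'.exists_mem hF' (hmem a)
  rw [sum_coord_eq hcard hF hg z hz hzF j P hP, sum_coord_eq hcard hF' hg' z' hz' hzF' j P' hP']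
  refine Finset.sum_congr rfl fun a _ => ?_
  have h1 := redOp_sub_mem hm hFF (hPm a)
  obtain ⟨q, hq, hq'⟩ := hg'.exists_mem hF' h1
  have h2 : q = P' a - P a := by
    rw [← sub_eq_zero]
    apply hg'
    have h3 := hP a
    rw [← hP' a] at h3
    rw [map_sub, map_sub, smul_sub, smul_sub]
    linear_combination hq' + h3
  have h4 : coeff (boxExp a) (P' a - P a) = 0 := by
    rw [← h2, ← notMem_support_iff]
    intro h
    have h5 := ((mem_restrictSupport_iff ℂ).1 hq) h
    simp at h5
  rw [coeff_sub, sub_eq_zero] at h4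
  rw [h4]

lemma roots_reverse_prod (s : Multiset ℂ) (hs : ∀ x ∈ s, x ≠ 0) :
    ((s.map fun a => Polynomial.X - Polynomial.C a).prod.reverse).roots = s.map (·⁻¹) := by
  induction s using Multiset.induction_on with
  | empty =>
    simp only [Multiset.map_zero, Multiset.prod_zero]
    rw [← Polynomial.C_1, Polynomial.reverse_C, Polynomial.roots_C]
  | cons a s ih =>
    have ha : a ≠ 0 := hs a (by simp)
    have hs' : ∀ x ∈ s, x ≠ 0 := fun x hx => hs x (by simp [hx])
    have h1 : (Polynomial.X - Polynomial.C a).reverse =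
        Polynomial.C (-a) * (Polynomial.X - Polynomial.C a⁻¹) := by
      have h0 : (Polynomial.X - Polynomial.C a) = Polynomial.C 1 * Polynomial.X + Polynomial.C (-a) := by
        simp [sub_eq_add_neg]
      have h2 : (Polynomial.X - Polynomial.C a).natDegree = 1 := Polynomial.natDegree_X_sub_C a
      ext i
      rw [Polynomial.coeff_reverse, h2]
      rcases i with _ | _ | i
      · simp [Polynomial.revAt_le, ha, Polynomial.coeff_C]
      · simp [Polynomial.revAt_le, Polynomial.coeff_C, Polynomial.coeff_X]
      · rw [Polynomial.revAt_eq_self_of_lt (by omega), Polynomial.coeff_C_mul]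
        simp [Polynomial.coeff_C, Polynomial.coeff_X]
    have hne : ((s.map fun a => Polynomial.X - Polynomial.C a).prod.reverse) ≠ 0 := by
      rw [Ne, Polynomial.reverse_eq_zero]
      exact (Polynomial.monic_multiset_prod_of_monic _ _
        (fun a _ => Polynomial.monic_X_sub_C a)).ne_zero
    rw [Multiset.map_cons, Multiset.prod_cons, Polynomial.reverse_mul_of_domain,
      Polynomial.roots_mul, ih hs', h1, Polynomial.roots_C_mul _ (neg_ne_zero.2 ha),
      Polynomial.roots_X_sub_C, Multiset.map_cons, Multiset.singleton_add]
    rw [h1]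
    exact mul_ne_zero (mul_ne_zero (by simpa using ha) (Polynomial.X_sub_C_ne_zero _)) hne

lemma isUnit_of_roots {n : ℕ} (A : Matrix (Fin n) (Fin n) ℂ)
    (h : ∀ x ∈ A.charpoly.roots, x ≠ 0) : IsUnit A := by
  rw [Matrix.isUnit_iff_isUnit_det, isUnit_iff_ne_zero, Matrix.det_eq_prod_roots_charpoly]
  exact Multiset.prod_ne_zero fun h0 => h 0 h0 rfl

lemma trace_inv {n : ℕ} (A : Matrix (Fin n) (Fin n) ℂ)
    (h : ∀ x ∈ A.charpoly.roots, x ≠ 0) :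
    A⁻¹.trace = (A.charpoly.roots.map (·⁻¹)).sum := by
  have hA := isUnit_of_roots A h
  have hd : A.det ≠ 0 := ((Matrix.isUnit_iff_isUnit_det A).1 hA).ne_zero
  rw [Matrix.trace_eq_sum_roots_charpoly, Matrix.charpoly_inv A hA, ← Matrix.reverse_charpoly]
  have h1 : A.charpoly = (A.charpoly.roots.map fun a => Polynomial.X - Polynomial.C a).prod :=
    (IsAlgClosed.splits A.charpoly).eq_prod_roots_of_monic A.charpoly_monic
  have h2 := roots_reverse_prod _ h
  rw [← h1] at h2
  have h3 : ((-1) ^ Fintype.card (Fin n) * Polynomial.C (Ring.inverse A.det) : Polynomial ℂ) =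
     Polynomial.C ((-1) ^ Fintype.card (Fin n) * Ring.inverse A.det) := by simp
  rw [h3, Polynomial.roots_C_mul _ (by simp [hd]), h2]

lemma hasStrictFDerivAt_eval {n : ℕ} (p : MvPolynomial (Fin n) ℂ) (z : Fin n → ℂ) :
    HasStrictFDerivAt (fun q : Fin n → ℂ => eval q p)
      (∑ j, eval z (pderiv j p) • (ContinuousLinearMap.proj j : (Fin n → ℂ) →L[ℂ] ℂ)) z := by
  induction p using MvPolynomial.induction_on with
  | C a =>
    simp only [eval_C]
    refine (hasStrictFDerivAt_const (𝕜 := ℂ) a z).congr_fderiv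
      (ContinuousLinearMap.ext fun u => ?_)
    simp
  | add p q hp hq =>
    simp only [map_add]
    refine (hp.add hq).congr_fderiv (ContinuousLinearMap.ext fun u => ?_)
    simp [add_mul, Finset.sum_add_distrib]
  | mul_X p i hp =>
    have h := hp.mul (ContinuousLinearMap.proj (R := ℂ) (φ := fun _ : Fin n => ℂ) i).hasStrictFDerivAt (x := z)
    simp only [map_mul, eval_X]
    refine h.congr_fderiv (ContinuousLinearMap.ext fun u => ?_)
    have h1 : ∀ j, eval z (pderiv j (p * X i)) =
        eval z (pderiv j p) * z i + eval z p * (if i = j then 1 else 0) := by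
      intro j
      rw [pderiv_mul, pderiv_X, map_add, map_mul, map_mul, eval_X]
      by_cases hij : i = j
      · subst hij; simp
      · simp [Pi.single_apply, hij]
    simp only [h1]
    simp [add_mul, Finset.sum_add_distrib, Finset.mul_sum]
    rw [add_comm]
    congr 1
    exact Finset.sum_congr rfl fun x _ => by ring

/-- Deform the system. -/
lemma exists_branch {n m : ℕ} (H : Fin n → MvPolynomial (Fin n) ℂ) (z : Fin n → ℂ)
    (hz : ∀ i, eval z (H i) = 0)
    (hJ : IsUnit (Matrix.of fun i j => eval z (pderiv j (H i)))) :
    ∃ (g : (Fin n → ℂ) × ℂ → Fin n → ℂ) (g' : (Fin n → ℂ) × ℂ →L[ℂ] (Fin n → ℂ)),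
      HasStrictFDerivAt g g' 0 ∧ g 0 = z ∧
      (∀ w, g' (w, 0) = (Matrix.of fun i j => eval z (pderiv j (H i)))⁻¹.mulVec w) ∧
      ∀ᶠ x in nhds (0 : (Fin n → ℂ) × ℂ),
        ∀ i, x.2 * g x i ^ m + eval (g x) (H i) = x.1 i := by
  set J : Matrix (Fin n) (Fin n) ℂ := Matrix.of fun i j => eval z (pderiv j (H i)) with hJdef
  have hJd : IsUnit J.det := (Matrix.isUnit_iff_isUnit_det J).1 hJ
  let Ψ : (Fin n → ℂ) × ℂ → (Fin n → ℂ) × ℂ :=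
    fun x => (fun i => x.2 * x.1 i ^ m + eval x.1 (H i), x.2)
  let A : ((Fin n → ℂ) × ℂ) ≃ₗ[ℂ] ((Fin n → ℂ) × ℂ) :=
    { toFun := fun x => (fun i => x.2 * z i ^ m + J.mulVec x.1 i, x.2)
      map_add' := fun x y => by
        ext i
        · simp [Matrix.mulVec_add]; ring
        · simp
      map_smul' := fun c x => by
        ext i
        · simp [Matrix.mulVec_smul]; ring
        · simp
      invFun := fun x => (J⁻¹.mulVec (fun i => x.1 i - x.2 * z i ^ m), x.2)
      left_inv := fun x => by
        ext i
        · simp [Matrix.nonsing_inv_mul _ hJd]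
        · simp
      right_inv := fun x => by
        ext i
        · simp [Matrix.mul_nonsing_inv _ hJd]
        · simp }
  let A' := A.toContinuousLinearEquiv
  have hΨ : HasStrictFDerivAt Ψ (A' : ((Fin n → ℂ) × ℂ) →L[ℂ] ((Fin n → ℂ) × ℂ)) (z, 0) := by
    have h1 : ∀ i, HasStrictFDerivAt (fun x : (Fin n → ℂ) × ℂ => x.2 * x.1 i ^ m + eval x.1 (H i))
       ((ContinuousLinearMap.proj (R := ℂ) (φ := fun _ : Fin n => ℂ) i).comp ((ContinuousLinearMap.fst ℂ _ _).comp (A' : ((Fin n → ℂ) × ℂ) →L[ℂ] ((Fin n → ℂ) × ℂ)))) (z, 0) := by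
      intro i
      have ha := (hasStrictFDerivAt_eval (H i) z).comp ((z, 0) : (Fin n → ℂ) × ℂ)
        (hasStrictFDerivAt_fst (𝕜 := ℂ))
      have hc := ((ContinuousLinearMap.proj (R := ℂ) (φ := fun _ : Fin n => ℂ) i).hasStrictFDerivAt (x := z)).comp ((z, 0) : (Fin n → ℂ) × ℂ)
        (hasStrictFDerivAt_fst (𝕜 := ℂ))
      have hb := ((hasStrictFDerivAt_snd (𝕜 := ℂ) (p := ((z, 0) : (Fin n → ℂ) × ℂ))).mul (hc.pow m)).add ha
      refine hb.congr_fderiv ?_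
      ext u
      · simp [A', A, J, Matrix.mulVec, dotProduct]
      · simp [A', A, J, Matrix.mulVec, dotProduct]
    have h2 := (hasStrictFDerivAt_pi.2 h1).prodMk
      (hasStrictFDerivAt_snd (𝕜 := ℂ) (p := ((z, 0) : (Fin n → ℂ) × ℂ)))
    refine h2.congr_fderiv ?_
    ext u <;> simp [A', A]
  have hΨ0 : Ψ (z, 0) = 0 := by
    ext i <;> simp [Ψ, hz]
  let G := hΨ.localInverse
  have hG1 := hΨ.to_localInverse
  have hG2 : G (Ψ (z, 0)) = (z, 0) := hΨ.localInverse_apply_image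
  have hG3 := hΨ.eventually_right_inverse
  rw [hΨ0] at hG1 hG2 hG3
  refine ⟨fun x => (G x).1, (ContinuousLinearMap.fst ℂ _ _).comp (A'.symm : ((Fin n → ℂ) × ℂ) →L[ℂ] ((Fin n → ℂ) × ℂ)), ?_, ?_, ?_, ?_⟩
  · exact (hasStrictFDerivAt_fst (𝕜 := ℂ)).comp _ hG1
  · simp [hG2]
  · intro w
    change (A.symm (w, 0)).1 = _
    simp [A]
  · filter_upwards [hG3] with x hx i
    have hx' : Ψ (G x) = x := hx
    have h1 : (G x).2 = x.2 := by
      have := congrArg Prod.snd hx'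
      simpa only [Ψ] using this
    have h2 := congrFun (congrArg Prod.fst hx') i
    simp only [Ψ, h1] at h2
    exact h2

/-- The multidimensional residue relation for the trace of the inverse Jacobian. -/
lemma sum_inv_diag {n m : ℕ} (hm : 2 ≤ m) {ι : Type*} [Fintype ι]
    (hcard : Fintype.card ι = m ^ n) (H : Fin n → MvPolynomial (Fin n) ℂ)
    (hH : ∀ i, (H i).totalDegree ≤ m) (z : ι → Fin n → ℂ) (hz : Function.Injective z)
    (hzH : ∀ s i, eval (z s) (H i) = 0)
    (hJ : ∀ s, IsUnit (Matrix.of fun i j => eval (z s) (pderiv j (H i)))) (j : Fin n) :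
    ∑ s, (Matrix.of fun i j => eval (z s) (pderiv j (H i)))⁻¹ j j = 0 := by
  choose g g' hg hg0 hg' hgz using fun s => exists_branch (m := m) H (z s) (hzH s) (hJ s)
  let c : (Fin n → ℂ) × ℂ → ℂ := fun x => ∑ s, g s x j
  let c' : (Fin n → ℂ) × ℂ →L[ℂ] ℂ :=
    ∑ s, (ContinuousLinearMap.proj (R := ℂ) (φ := fun _ : Fin n => ℂ) j).comp (g' s)
  have hc : HasStrictFDerivAt c c' 0 := by
    refine HasStrictFDerivAt.fun_sum fun s _ => ?_
    exact (ContinuousLinearMap.proj (R := ℂ)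
      (φ := fun _ : Fin n => ℂ) j).hasStrictFDerivAt.comp 0 (hg s)
  let e : Fin n → ℂ := Pi.single j 1
  have he : ‖e‖ = 1 := by
    rw [show e = Pi.single j 1 from rfl, Pi.norm_single, norm_one]
  have hce : c' (e, 0) = ∑ s, (Matrix.of fun i j => eval (z s) (pderiv j (H i)))⁻¹ j j := by
    simp only [c', _root_.sum_apply, ContinuousLinearMap.comp_apply, hg']
    simp [e]
  rw [← hce]
  have hev : ∀ᶠ x in nhds (0 : (Fin n → ℂ) × ℂ),
      (∀ s i, x.2 * g s x i ^ m + eval (g s x) (H i) = x.1 i) ∧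
        Function.Injective fun s => g s x := by
    refine (Filter.eventually_all.2 hgz).and ?_
    have : ∀ s t, ∀ᶠ x in nhds (0 : (Fin n → ℂ) × ℂ), g s x = g t x → s = t := by
      intro s t
      by_cases hst : s = t
      · exact Filter.Eventually.of_forall fun _ _ => hst
      · have h1 : g s 0 ≠ g t 0 := by rw [hg0, hg0]; exact hz.ne hst
        have h2 := ((hg s).hasFDerivAt.continuousAt.tendsto.sub
          (hg t).hasFDerivAt.continuousAt.tendsto).eventually_ne (sub_ne_zero.2 h1)
        exact h2.mono fun x hx h => absurd (sub_eq_zero.2 h) hx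
    have h3 := Filter.eventually_all.2 fun s => Filter.eventually_all.2 (this s)
    exact h3.mono fun x hx s t h => hx s t h
  by_contra hne
  have hpos : 0 < ‖c' (e, 0)‖ := norm_pos_iff.2 hne
  have hlo := hc.isLittleO.def (half_pos hpos)
  obtain ⟨r, hr, hball⟩ := Metric.eventually_nhds_iff_ball.1
    ((hev.prod_nhds hev).and hlo)
  have key : ∀ w : Fin n → ℂ, ∀ i, (H i - C (w i)).totalDegree ≤ m := fun w i =>
    (totalDegree_sub_C_le _ _).trans (hH i)
  let t : ℂ := ((r / 2 : ℝ) : ℂ)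
  have ht : ‖t‖ = r / 2 := by
    simp only [t, Complex.norm_real, Real.norm_eq_abs]
    exact abs_of_pos (half_pos hr)
  obtain ⟨ε, hε0, hεr, hgood, hgood'⟩ := exists_goodEps (m := m)
    (fun i => H i - C ((t • e) i)) (fun i => H i - C ((0 : Fin n → ℂ) i)) hr
  have hx := hball (((t • e), ε), (0, ε)) (by
    rw [Metric.mem_ball, dist_eq_norm]
    have h1 : ‖t • e‖ < r := by rw [norm_smul, he, ht]; linarith
    simp only [Prod.norm_def, Prod.fst_sub, Prod.snd_sub, Prod.fst_zero, Prod.snd_zero, sub_zero,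
      norm_zero]
    exact max_lt (max_lt h1 hεr) (max_lt hr hεr))
  obtain ⟨⟨⟨hx1, hx2⟩, ⟨hy1, hy2⟩⟩, hxy⟩ := hx
  have heq : c (t • e, ε) = c (0, ε) := by
    refine sum_coord_indep hm hcard (key (t • e)) (key 0) (fun i => ?_) hgood hgood' _ _ hx2 hy2
      (fun s i => ?_) (fun s i => ?_) j
    · have : H i - C ((t • e) i) - (H i - C ((0 : Fin n → ℂ) i)) = C (0 - (t • e) i) := by
        simp
      rw [this, totalDegree_C]
    · have := hx1 s i
      simp only [map_sub, eval_C]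
      linear_combination this
    · have := hy1 s i
      simp only [map_sub, eval_C]
      linear_combination this
  have hsub : ((t • e, ε) : (Fin n → ℂ) × ℂ) - (0, ε) = t • (e, 0) := by
    ext <;> simp
  simp only at hxy
  rw [heq, sub_self, hsub, zero_sub, norm_neg, map_smul, norm_smul, norm_smul, ht] at hxy
  have hn1 : ‖((e, 0) : (Fin n → ℂ) × ℂ)‖ = 1 := by simp [Prod.norm_def, he]
  rw [hn1] at hxy
  have : 0 < r * ‖c' (e, 0)‖ := mul_pos hr hpos
  nlinarith

/-- Let `V` be homogeneous of degree `k > 2` in `n ≥ 2` variables with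
the maximal number `(k-1)ⁿ - 1` of normalized Darboux points, at each of which all the
Kovalevskaya exponents (eigenvalues of `K(d) = V''(d) - E`) are nonzero.  With
`Λ₁(d),…,Λ_{n-1}(d)` the nontrivial Kovalevskaya exponents at `d`:
`Σ_{d ∈ 𝓓} Σ_{i=1}^{n-1} 1/Λᵢ(d) = -((k-1)ⁿ - n(k-2) - 1)/(k-2)`. -/
theorem potential_relation_sum_inverses
    (n k : ℕ) (hn : 2 ≤ n) (hk : 2 < k)
    (V : MvPolynomial (Fin n) ℂ) (hV : V.IsHomogeneous k)
    (D : Finset (Fin n → ℂ))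
    (hD : ∀ d, d ∈ D ↔ d ≠ 0 ∧ ∀ i, eval d (pderiv i V) = d i)
    (hcard : D.card = (k - 1) ^ n - 1)
    (hK : ∀ d ∈ D, ∀ x ∈
      ((Matrix.of fun i j => eval d (pderiv i (pderiv j V))) - 1).charpoly.roots, x ≠ 0)
    (Λ : (Fin n → ℂ) → Fin (n - 1) → ℂ)
    (hΛ : ∀ d ∈ D,
      ((Matrix.of fun i j => eval d (pderiv i (pderiv j V))) - 1).charpoly.roots
        = ((k : ℂ) - 2) ::ₘ Multiset.map (Λ d) Finset.univ.val) :
    ∑ d ∈ D, ∑ j, 1 / Λ d j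
      = -(((k : ℂ) - 1) ^ n - (n : ℂ) * ((k : ℂ) - 2) - 1) / ((k : ℂ) - 2) := by
  classical
  have hm : 2 ≤ k - 1 := by omega
  have hpos : 0 < (k - 1) ^ n := Nat.pow_pos (by omega)
  have hk2 : ((k : ℂ) - 2) ≠ 0 := by
    rw [sub_ne_zero]
    exact_mod_cast (by omega : k ≠ 2)
  have hD0 : (0 : Fin n → ℂ) ∉ D := fun h => ((hD 0).1 h).1 rfl
  let H : Fin n → MvPolynomial (Fin n) ℂ := fun i => pderiv i V - X i
  let K : (Fin n → ℂ) → Matrix (Fin n) (Fin n) ℂ :=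
    fun d => (Matrix.of fun i j => eval d (pderiv i (pderiv j V))) - 1
  have hJK : ∀ d, (Matrix.of fun i j => eval d (pderiv j (H i))) = (K d).transpose := by
    intro d
    ext i j
    by_cases hij : i = j
    · subst hij
      simp [H, K]
    · simp [H, K, Matrix.one_apply, Ne.symm hij, pderiv_X, Pi.single_apply, hij]
  have heval0 : ∀ (p : MvPolynomial (Fin n) ℂ) (d : ℕ), d ≠ 0 → p.IsHomogeneous d →
      eval (0 : Fin n → ℂ) p = 0 := by
    intro p d hd0 hp
    rw [eval_zero, constantCoeff_eq]
    exact hp.coeff_eq_zero (by simpa using hd0.symm)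
  have hK0 : K 0 = -1 := by
    have : ∀ i j, eval (0 : Fin n → ℂ) (pderiv i (pderiv j V)) = 0 := by
      intro i j
      have h1 : (pderiv i (pderiv j V)).IsHomogeneous (k - 1 - 1) := hV.pderiv.pderiv
      exact heval0 _ _ (by omega) h1
    ext i j
    simp only [K, Matrix.sub_apply, Matrix.of_apply, this, zero_sub, Matrix.neg_apply]
  have hunit : ∀ d ∈ insert 0 D, IsUnit (K d) := by
    intro d hd
    rcases Finset.mem_insert.1 hd with rfl | hd
    · rw [hK0]; exact isUnit_one.neg
    · exact isUnit_of_roots _ (hK d hd)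
  have hsum : ∀ j, ∑ d ∈ insert 0 D, (K d)⁻¹ j j = 0 := by
    intro j
    have h := sum_inv_diag (ι := ↥(insert 0 D)) hm
      (by rw [Fintype.card_coe, Finset.card_insert_of_notMem hD0, hcard]; omega) H
      (fun i => by
        refine (totalDegree_sub _ _).trans (max_le hV.pderiv.totalDegree_le ?_)
        rw [totalDegree_X]; omega)
      (fun d => d.1) Subtype.coe_injective
      (fun d i => by
        rcases Finset.mem_insert.1 d.2 with h0 | hd
        · have h1 : (pderiv i V).IsHomogeneous (k - 1) := hV.pderiv
          have h2 := heval0 _ _ (by omega) h1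
          simp only [H, h0, map_sub, h2, eval_X, Pi.zero_apply, sub_zero]
        · simp [H, ((hD _).1 hd).2 i])
      (fun d => by
        rw [hJK, Matrix.isUnit_transpose]
        exact hunit d.1 d.2) j
    simp only [hJK] at h
    rw [← Finset.sum_coe_sort]
    simpa [← Matrix.transpose_nonsing_inv] using h
  have htr : ∑ d ∈ insert 0 D, (K d)⁻¹.trace = 0 := by
    simp only [Matrix.trace, Matrix.diag_apply]
    rw [Finset.sum_comm]
    exact Finset.sum_eq_zero fun j _ => hsum j
  rw [Finset.sum_insert hD0, hK0] at htr
  have htr0 : ((-1 : Matrix (Fin n) (Fin n) ℂ)⁻¹).trace = -(n : ℂ) := by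
    have : (-1 : Matrix (Fin n) (Fin n) ℂ)⁻¹ = -1 :=
      Matrix.inv_eq_left_inv (by simp)
    rw [this]; simp
  have hd : ∀ d ∈ D, (K d)⁻¹.trace = ((k : ℂ) - 2)⁻¹ + ∑ j, 1 / Λ d j := by
    intro d hd
    rw [trace_inv _ (hK d hd), hΛ d hd]
    simp only [Multiset.map_cons, Multiset.sum_cons, Multiset.map_map, Function.comp_def, one_div]
    rfl
  rw [htr0, Finset.sum_congr rfl hd, Finset.sum_add_distrib, Finset.sum_const, hcard,
    nsmul_eq_mul, Nat.cast_sub hpos, Nat.cast_pow, Nat.cast_sub (by omega)] at htr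
  push_cast at htr
  field_simp
  field_simp at htr
  linear_combination htr
end

section
/- Let V ∈ ℂ[q₁,q₂] be homogeneous of degree k > 2 such that the set 𝓓 = {d ∈ ℂ² \ {0} : V'(d) = d} has exactly (k−1)² − 1 = k(k−2) elements and, for each d ∈ 𝓓, the nontrivial Kovalevskaya exponent Λ(d) = tr V''(d) − k is nonzero. Then Σ_{d ∈ 𝓓} 1/Λ(d) = −(k−2). (Equivalently, with Λ₁,…,Λ_k the nontrivial Kovalevskaya exponents at the k Darboux points in projective space, Σ_{i=1}^{k} 1/Λᵢ = −1.) -/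
open MvPolynomial

lemma eval_smul_homog {n : ℕ} {P : MvPolynomial (Fin 2) ℂ} (hP : P.IsHomogeneous n)
    (c : ℂ) (d : Fin 2 → ℂ) : eval (c • d) P = c ^ n * eval d P := by
  rw [eval_eq', eval_eq', Finset.mul_sum]
  refine Finset.sum_congr rfl fun m hm => ?_
  have h1 : m.degree = n := by
    by_contra h
    exact (mem_support_iff.mp hm) (hP.coeff_eq_zero h)
  have h2 : m 0 + m 1 = n := by
    rw [← h1, Finsupp.degree_eq_sum, Fin.sum_univ_two]
  simp only [Fin.prod_univ_two, Pi.smul_apply, smul_eq_mul, mul_pow, ← h2, pow_add]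
  ring

lemma derivative_aeval_two (g : Fin 2 → Polynomial ℂ) (P : MvPolynomial (Fin 2) ℂ) :
    Polynomial.derivative (aeval g P) =
      aeval g (pderiv 0 P) * Polynomial.derivative (g 0)
      + aeval g (pderiv 1 P) * Polynomial.derivative (g 1) := by
  induction P using MvPolynomial.induction_on with
  | C a => simp
  | add p q hp hq => simp only [map_add, hp, hq]; ring
  | mul_X p i hp =>
    fin_cases i <;>
    · simp [hp, pderiv_X]
      ring

lemma exists_slope (D : Finset (Fin 2 → ℂ)) (h0 : ∀ d ∈ D, d ≠ 0) :
    ∃ b : ℂ, ∀ d ∈ D, d 0 + b * d 1 ≠ 0 := by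
  classical
  obtain ⟨b, hb⟩ := Infinite.exists_notMem_finset (D.image fun d => - d 0 / d 1)
  refine ⟨b, fun d hd h => ?_⟩
  by_cases h1 : d 1 = 0
  · apply h0 d hd
    have : d 0 = 0 := by simpa [h1] using h
    funext i
    fin_cases i <;> simp [h1, this]
  · apply hb
    refine Finset.mem_image.mpr ⟨d, hd, ?_⟩
    field_simp
    linear_combination -h

/-- Sum of `A / f'` over a full set of simple roots. -/
lemma sum_div_derivative (k : ℕ) (hk : 0 < k) (f A : Polynomial ℂ) (T : Finset ℂ)
    (hT : T.card = k) (hf : f.natDegree ≤ k) (hA : A.natDegree ≤ k - 1)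
    (hc : f.coeff k = A.coeff (k - 1)) (hroot : ∀ t ∈ T, f.eval t = 0)
    (hder : ∀ t ∈ T, (Polynomial.derivative f).eval t ≠ 0) :
    ∑ t ∈ T, A.eval t / (Polynomial.derivative f).eval t = 1 := by
  classical
  set c := f.coeff k with hcdef
  have hnd : (Lagrange.nodal T (id : ℂ → ℂ)).natDegree = k := by
    rw [Lagrange.natDegree_nodal, hT]
  have hmonic : (Lagrange.nodal T (id : ℂ → ℂ)).Monic := Lagrange.nodal_monic
  have hfeq : f = Polynomial.C c * Lagrange.nodal T id := by
    apply Polynomial.eq_of_degree_sub_lt_of_eval_finset_eq T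
    · rw [hT, Polynomial.degree_lt_iff_coeff_zero]
      intro m hm
      rcases hm.eq_or_lt with rfl | hm
      · have := hmonic.coeff_natDegree
        rw [hnd] at this
        simp [this, hcdef]
      · rw [Polynomial.coeff_sub, Polynomial.coeff_C_mul,
          Polynomial.coeff_eq_zero_of_natDegree_lt (by omega),
          Polynomial.coeff_eq_zero_of_natDegree_lt (p := Lagrange.nodal T id) (by omega)]
        simp
    · intro t ht
      have := Lagrange.eval_nodal_at_node (v := (id : ℂ → ℂ)) ht
      simp only [id] at this
      simp [hroot t ht, this]
  have hd : ∀ t ∈ T, (Polynomial.derivative f).eval t = c * ∏ j ∈ T.erase t, (t - j) := by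
    intro t ht
    have := Lagrange.eval_nodal_derivative_eval_node_eq (v := (id : ℂ → ℂ)) ht
    simp only [id] at this
    rw [hfeq, Polynomial.derivative_C_mul, Polynomial.eval_C_mul, this, Lagrange.eval_nodal]
    rfl
  have hne : T.Nonempty := Finset.card_pos.mp (by omega)
  obtain ⟨t0, ht0⟩ := hne
  have hc0 : c ≠ 0 := by
    intro h
    apply hder t0 ht0
    rw [hd t0 ht0, h, zero_mul]
  have hsum := Lagrange.coeff_eq_sum (s := T) (v := (id : ℂ → ℂ)) (Set.injOn_id _) (P := A) (by
    refine lt_of_le_of_lt Polynomial.degree_le_natDegree ?_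
    rw [hT]
    exact_mod_cast (by omega : A.natDegree < k))
  rw [hT, ← hc] at hsum
  simp only [id] at hsum
  calc ∑ t ∈ T, A.eval t / (Polynomial.derivative f).eval t
      = ∑ t ∈ T, (A.eval t / ∏ j ∈ T.erase t, (t - j)) / c := by
        refine Finset.sum_congr rfl fun t ht => ?_
        rw [hd t ht, div_div, mul_comm]
    _ = 1 := by rw [← Finset.sum_div, ← hsum, div_self hc0]

/-- Let `V` be homogeneous of degree `k > 2` in two variables with the
maximal number `(k-1)² - 1 = k(k-2)` of normalized Darboux points, and assume the
nontrivial Kovalevskaya exponent `Λ(d) = tr V''(d) - k` is nonzero at each of them.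
Then `Σ_{d ∈ 𝓓} 1/Λ(d) = -(k-2)` (equivalently, summing over the `k` Darboux points in
projective space, `Σᵢ 1/Λᵢ = -1`). -/
theorem two_dim_relation
    (k : ℕ) (hk : 2 < k)
    (V : MvPolynomial (Fin 2) ℂ) (hV : V.IsHomogeneous k)
    (D : Finset (Fin 2 → ℂ))
    (hD : ∀ d, d ∈ D ↔ d ≠ 0 ∧ ∀ i, eval d (pderiv i V) = d i)
    (hcard : D.card = (k - 1) ^ 2 - 1)
    (hΛ : ∀ d ∈ D,
      (Matrix.of fun i j : Fin 2 => eval d (pderiv i (pderiv j V))).trace - (k : ℂ) ≠ 0) :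
    ∑ d ∈ D, 1 / ((Matrix.of fun i j : Fin 2 => eval d (pderiv i (pderiv j V))).trace - (k : ℂ))
      = -((k : ℂ) - 2) := by
  classical
  obtain ⟨m, rfl⟩ : ∃ m, k = m + 2 := ⟨k - 2, by omega⟩
  have hm : 0 < m := by omega
  obtain ⟨b, hb⟩ := exists_slope D fun d hd => ((hD d).mp hd).1
  set Λ : (Fin 2 → ℂ) → ℂ := fun d =>
    (Matrix.of fun i j : Fin 2 => eval d (pderiv i (pderiv j V))).trace - ((m + 2 : ℕ) : ℂ) with hΛdef
  have hΛ' : ∀ d, Λ d = eval d (pderiv 0 (pderiv 0 V)) + eval d (pderiv 1 (pderiv 1 V)) - (m + 2) := by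
    intro d
    simp [hΛdef, Matrix.trace, Fin.sum_univ_two]
  change ∑ d ∈ D, 1 / Λ d = _
  change ∀ d ∈ D, Λ d ≠ 0 at hΛ
  have hV1 : ∀ i, (pderiv i V).IsHomogeneous (m + 1) := fun i => hV.pderiv
  have hV2 : ∀ i j, (pderiv i (pderiv j V)).IsHomogeneous m := fun i j => (hV1 j).pderiv
  -- the affine line
  set g : Fin 2 → Polynomial ℂ :=
    ![1 + Polynomial.C b * Polynomial.X, -Polynomial.X] with hg
  have hg1 : ∀ i, (g i).natDegree ≤ 1 := by
    intro i
    fin_cases i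
    · simp only [hg]
      simp only [Fin.zero_eta, Matrix.cons_val_zero]
      compute_degree
    · simp [hg]
  set A : Polynomial ℂ := aeval g (pderiv 0 V) + Polynomial.C b * aeval g (pderiv 1 V) with hA
  set B : Polynomial ℂ := aeval g (pderiv 1 V) with hB
  set f : Polynomial ℂ := B + Polynomial.X * A with hf
  have hdeg : ∀ i, (aeval g (pderiv i V) : Polynomial ℂ).natDegree ≤ m + 1 := fun i => by
    simpa using aeval_natDegree_le (pderiv i V) (hV1 i).totalDegree_le g hg1
  have hAdeg : A.natDegree ≤ m + 1 :=
    Polynomial.natDegree_add_le_of_degree_le (hdeg 0)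
      ((Polynomial.natDegree_C_mul_le _ _).trans (hdeg 1))
  have hfdeg : f.natDegree ≤ m + 2 := by
    refine Polynomial.natDegree_add_le_of_degree_le ((hdeg 1).trans (by omega)) ?_
    refine Polynomial.natDegree_mul_le.trans ?_
    rw [Polynomial.natDegree_X]
    omega
  have hcoeff : f.coeff (m + 2) = A.coeff (m + 2 - 1) := by
    have : B.coeff (m + 2) = 0 :=
      Polynomial.coeff_eq_zero_of_natDegree_lt (lt_of_le_of_lt (hdeg 1) (by omega))
    rw [hf, Polynomial.coeff_add, this, zero_add]
    exact Polynomial.coeff_X_mul A (m + 1)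
  -- evaluation
  have hev : ∀ (t : ℂ) (P : MvPolynomial (Fin 2) ℂ),
      (aeval g P : Polynomial ℂ).eval t = eval ![1 + b * t, -t] P := by
    intro t P
    induction P using MvPolynomial.induction_on with
    | C a => simp
    | add p q hp hq => simp [hp, hq]
    | mul_X p i hp =>
      rw [map_mul, map_mul, Polynomial.eval_mul, hp, aeval_X, eval_X]
      congr 1
      fin_cases i <;> simp [hg]
  set L : (Fin 2 → ℂ) → ℂ := fun d => d 0 + b * d 1 with hL
  set τ : (Fin 2 → ℂ) → ℂ := fun d => - d 1 / L d with hτ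
  have hpt : ∀ d ∈ D, d = L d • ![1 + b * τ d, -τ d] := by
    intro d hd
    have h := hb d hd
    change L d ≠ 0 at h
    funext i
    fin_cases i
    · simp [hτ]; field_simp; simp [hL]
    · simp [hτ]; field_simp
  have hev' : ∀ (n : ℕ) (P : MvPolynomial (Fin 2) ℂ), P.IsHomogeneous n → ∀ d ∈ D,
      eval d P = L d ^ n * (aeval g P : Polynomial ℂ).eval (τ d) := by
    intro n P hP d hd
    conv_lhs => rw [hpt d hd]
    rw [eval_smul_homog hP, hev]
  have hL0 : ∀ d ∈ D, L d ≠ 0 := hb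
  have hτL : ∀ d ∈ D, τ d * L d = - d 1 := fun d hd => div_mul_cancel₀ _ (hL0 d hd)
  have e1 : ∀ d ∈ D, ∀ i, L d ^ (m + 1) * (aeval g (pderiv i V) : Polynomial ℂ).eval (τ d) = d i :=
    fun d hd i => by rw [← hev' _ _ (hV1 i) d hd]; exact ((hD d).mp hd).2 i
  have eA : ∀ d ∈ D, L d ^ m * A.eval (τ d) = 1 := by
    intro d hd
    have h : L d * (L d ^ m * A.eval (τ d)) = L d * 1 := by
      have h0 := e1 d hd 0
      have h1 := e1 d hd 1
      rw [hA, Polynomial.eval_add, Polynomial.eval_C_mul]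
      have : L d = d 0 + b * d 1 := rfl
      linear_combination h0 + b * h1 - this
    exact mul_left_cancel₀ (hL0 d hd) h
  have ef : ∀ d ∈ D, f.eval (τ d) = 0 := by
    intro d hd
    have h : L d ^ (m + 1) * f.eval (τ d) = L d ^ (m + 1) * 0 := by
      have h1 := e1 d hd 1
      have h2 := eA d hd
      have h3 := hτL d hd
      rw [hf, Polynomial.eval_add, Polynomial.eval_mul, Polynomial.eval_X]
      linear_combination h1 + τ d * L d * h2 + h3
    exact mul_left_cancel₀ (pow_ne_zero _ (hL0 d hd)) h
  have euler : ∀ d ∈ D, ∀ i, d 0 * eval d (pderiv 0 (pderiv i V))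
      + d 1 * eval d (pderiv 1 (pderiv i V)) = (m + 1) * d i := by
    intro d hd i
    have h := congrArg (eval d) (hV1 i).sum_X_mul_pderiv
    simp only [Fin.sum_univ_two, map_add, map_mul, eval_X, map_nsmul, ((hD d).mp hd).2 i] at h
    rw [h]
    simp
  have hdg0 : Polynomial.derivative (g 0) = Polynomial.C b := by simp [hg]
  have hdg1 : Polynomial.derivative (g 1) = -1 := by simp [hg]
  have ef' : ∀ d ∈ D, L d ^ m * (Polynomial.derivative f).eval (τ d) = - Λ d := by
    intro d hd
    have h : L d * (L d ^ m * (Polynomial.derivative f).eval (τ d)) = L d * (- Λ d) := by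
      have h00 := hev' _ _ (hV2 0 0) d hd
      have h01 := hev' _ _ (hV2 0 1) d hd
      have h10 := hev' _ _ (hV2 1 0) d hd
      have h11 := hev' _ _ (hV2 1 1) d hd
      have u0 := euler d hd 0
      have u1 := euler d hd 1
      have h2 := eA d hd
      have h3 := hτL d hd
      have hLd : L d = d 0 + b * d 1 := rfl
      have hder : (Polynomial.derivative f).eval (τ d) =
          ((aeval g (pderiv 0 (pderiv 1 V)) : Polynomial ℂ).eval (τ d) * b
            - (aeval g (pderiv 1 (pderiv 1 V)) : Polynomial ℂ).eval (τ d)) + A.eval (τ d)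
          + τ d * (((aeval g (pderiv 0 (pderiv 0 V)) : Polynomial ℂ).eval (τ d) * b
            - (aeval g (pderiv 1 (pderiv 0 V)) : Polynomial ℂ).eval (τ d))
            + b * ((aeval g (pderiv 0 (pderiv 1 V)) : Polynomial ℂ).eval (τ d) * b
            - (aeval g (pderiv 1 (pderiv 1 V)) : Polynomial ℂ).eval (τ d))) := by
        have hdA : Polynomial.derivative A =
            (aeval g (pderiv 0 (pderiv 0 V)) * Polynomial.C b + aeval g (pderiv 1 (pderiv 0 V)) * -1)
            + Polynomial.C b * (aeval g (pderiv 0 (pderiv 1 V)) * Polynomial.C b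
              + aeval g (pderiv 1 (pderiv 1 V)) * -1) := by
          rw [hA, Polynomial.derivative_add, Polynomial.derivative_C_mul, hB,
            derivative_aeval_two, derivative_aeval_two, hdg0, hdg1]
        rw [hf, Polynomial.derivative_add, Polynomial.derivative_mul, hdA, hB,
          derivative_aeval_two, hdg0, hdg1]
        simp only [Polynomial.eval_add, Polynomial.eval_mul, Polynomial.derivative_X,
          Polynomial.eval_C, Polynomial.eval_neg, Polynomial.eval_one, Polynomial.eval_X]
        ring
      rw [hder, hΛ' d]
      generalize (aeval g (pderiv 0 (pderiv 0 V)) : Polynomial ℂ).eval (τ d) = a00 at *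
      generalize (aeval g (pderiv 0 (pderiv 1 V)) : Polynomial ℂ).eval (τ d) = a01 at *
      generalize (aeval g (pderiv 1 (pderiv 0 V)) : Polynomial ℂ).eval (τ d) = a10 at *
      generalize (aeval g (pderiv 1 (pderiv 1 V)) : Polynomial ℂ).eval (τ d) = a11 at *
      generalize A.eval (τ d) = a at *
      generalize eval d (pderiv 0 (pderiv 0 V)) = v00 at *
      generalize eval d (pderiv 0 (pderiv 1 V)) = v01 at *
      generalize eval d (pderiv 1 (pderiv 0 V)) = v10 at *
      generalize eval d (pderiv 1 (pderiv 1 V)) = v11 at *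
      have key : L d * (L d ^ m * (a01 * b - a11 + a + τ d * (a00 * b - a10 + b * (a01 * b - a11))))
          = L d * (v01 * b - v11) + L d * 1
            + (- d 1) * (v00 * b - v10 + b * (v01 * b - v11)) := by
        rw [h00, h01, h10, h11, ← h2, ← h3]
        ring
      rw [key, hLd]
      linear_combination u0 + b * u1
    exact mul_left_cancel₀ (hL0 d hd) h
  have ef0 : ∀ d ∈ D, (Polynomial.derivative f).eval (τ d) ≠ 0 := by
    intro d hd h0
    have := ef' d hd
    rw [h0, mul_zero] at this
    exact hΛ d hd (by linear_combination this)
  have hterm : ∀ d ∈ D, 1 / Λ d = - (A.eval (τ d) / (Polynomial.derivative f).eval (τ d)) := by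
    intro d hd
    have h1 := eA d hd
    have h2 := ef' d hd
    have h3 := hΛ d hd
    have h4 := ef0 d hd
    have h5 := pow_ne_zero m (hL0 d hd)
    have : L d ^ m * (Polynomial.derivative f).eval (τ d) =
        L d ^ m * (- (Λ d * A.eval (τ d))) := by
      linear_combination h2 + Λ d * h1
    have := mul_left_cancel₀ h5 this
    rw [div_eq_iff h3, this]
    have hA0 : A.eval (τ d) ≠ 0 := by
      intro h; rw [h, mul_zero] at h1; exact zero_ne_one h1
    field_simp
  have hcard' : D.card = (m + 2) * m := by
    rw [hcard]
    have : (m + 2 - 1) ^ 2 = (m + 2) * m + 1 := by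
      have : m + 2 - 1 = m + 1 := by omega
      rw [this]; ring
    omega
  set T := D.image τ with hT
  have hmaps : ∀ d ∈ D, τ d ∈ T := fun d hd => Finset.mem_image_of_mem _ hd
  have hfib : ∀ t ∈ T, (D.filter fun d => τ d = t).card ≤ m := by
    intro t ht
    have hinj : Set.InjOn L (D.filter fun d => τ d = t : Finset (Fin 2 → ℂ)) := by
      intro d hd d' hd' h
      simp only [Finset.coe_filter, Set.mem_ofPred_eq] at hd hd'
      rw [hpt d hd.1, hpt d' hd'.1, hd.2, hd'.2, h]
    rw [← Finset.card_image_of_injOn hinj]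
    calc _ ≤ (Polynomial.nthRoots m (A.eval t)⁻¹).toFinset.card := by
          apply Finset.card_le_card
          intro z hz
          obtain ⟨d, hd, rfl⟩ := Finset.mem_image.mp hz
          rw [Finset.mem_filter] at hd
          rw [Multiset.mem_toFinset, Polynomial.mem_nthRoots hm]
          have := eA d hd.1
          rw [hd.2] at this
          exact eq_inv_of_mul_eq_one_left this
      _ ≤ _ := (Multiset.toFinset_card_le _).trans (Polynomial.card_nthRoots _ _)
  have hsumcard : D.card = ∑ t ∈ T, (D.filter fun d => τ d = t).card :=
    Finset.card_eq_sum_card_fiberwise hmaps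
  have hTge : m + 2 ≤ T.card := by
    have h : (m + 2) * m ≤ T.card * m := by
      rw [← hcard', hsumcard]
      simpa using Finset.sum_le_card_nsmul T _ m hfib
    exact Nat.le_of_mul_le_mul_right h hm
  have hTroot : ∀ t ∈ T, f.eval t = 0 := by
    intro t ht
    obtain ⟨d, hd, rfl⟩ := Finset.mem_image.mp ht
    exact ef d hd
  have hTder : ∀ t ∈ T, (Polynomial.derivative f).eval t ≠ 0 := by
    intro t ht
    obtain ⟨d, hd, rfl⟩ := Finset.mem_image.mp ht
    exact ef0 d hd
  have hTle : T.card ≤ m + 2 := by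
    have hf0 : f ≠ 0 := by
      obtain ⟨t, ht⟩ := Finset.card_pos.mp (by omega : 0 < T.card)
      intro h
      apply hTder t ht
      simp [h]
    refine le_trans ?_ hfdeg
    exact Polynomial.card_le_degree_of_subset_roots (fun t ht => by
      rw [Polynomial.mem_roots hf0]; exact hTroot t ht)
  have hTcard : T.card = m + 2 := le_antisymm hTle hTge
  have hfibeq : ∀ t ∈ T, (D.filter fun d => τ d = t).card = m := by
    refine (Finset.sum_eq_sum_iff_of_le hfib).mp ?_
    rw [← hsumcard, hcard', Finset.sum_const, hTcard, smul_eq_mul]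
  have hmain := sum_div_derivative (m + 2) (by omega) f A T hTcard hfdeg hAdeg hcoeff hTroot hTder
  rw [Finset.sum_congr rfl hterm, Finset.sum_neg_distrib,
    ← Finset.sum_fiberwise_of_maps_to hmaps]
  have : ∀ t ∈ T, ∑ d ∈ D.filter (fun d => τ d = t),
      A.eval (τ d) / (Polynomial.derivative f).eval (τ d)
      = (m : ℂ) * (A.eval t / (Polynomial.derivative f).eval t) := by
    intro t ht
    rw [← hfibeq t ht, ← nsmul_eq_mul, ← Finset.sum_const]
    refine Finset.sum_congr rfl fun d hd => ?_
    rw [(Finset.mem_filter.mp hd).2]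
  rw [Finset.sum_congr rfl this, ← Finset.mul_sum, hmain]
  push_cast
  ring
end
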